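/- arXiv:2512.15550 — 5 statements merged into one kernel-verified Lean document; each statement's English description precedes it below -/
import Mathlib

section
/- Let n be a natural number and let σ be a permutation of Fin n, thought of as rearranging a strictly decreasing array A = [a_0, …, a_{n-1}] into the array B with B_k = A_{σ(k)}. Let t be the number of inversions of the rearrangement, i.e. the cardinality of {(i, j) : i < j and σ⁻¹(j) < σ⁻¹(i)} (pairs of positions of A whose relative order is reversed in B). Then for every m with 1 ≤ m ≤ n, the number s of indices i < m with σ⁻¹(i) ≥ m (elements among the first m entries of A that do not appear among the first m entries of B) satisfies s ≤ ⌊√t⌋ (i.e. s ≤ Nat.sqrt t). -/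
/-- A permutation moves as many elements out of a set as it moves into it. -/
theorem Equiv.Perm.card_filter_and_not_comm {α : Type*} [Fintype α] (τ : Equiv.Perm α)
    (p : α → Prop) [DecidablePred p] :
    (Finset.univ.filter fun i => p i ∧ ¬ p (τ i)).card =
      (Finset.univ.filter fun i => p (τ i) ∧ ¬ p i).card := by
  classical
  have h : (Finset.univ.filter p).card = (Finset.univ.filter fun i => p (τ i)).card :=
    (Finset.card_equiv τ fun i => by simp).symm
  simpa only [← Finset.filter_and_not] using Finset.card_sdiff_comm h


/-- A permutation `σ` of `Fin n` rearranges a strictly decreasing array `A` into `B` with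
`B k = A (σ k)`.  `t` is the number of inversions, i.e. pairs of positions `(i, j)` with
`i < j` whose relative order is reversed in `B` (`σ⁻¹ j < σ⁻¹ i`).  For `1 ≤ m ≤ n`, the
number `s` of indices `i < m` with `σ⁻¹ i ≥ m` satisfies `s ≤ ⌊√t⌋`. -/
theorem sqrt_inversions_bound (n : ℕ) (σ : Equiv.Perm (Fin n))
    (m : ℕ) (hm1 : 1 ≤ m) (hmn : m ≤ n) :
    (Finset.univ.filter fun i : Fin n =>
        (i : ℕ) < m ∧ m ≤ ((σ⁻¹ i : Fin n) : ℕ)).card ≤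
      Nat.sqrt ((Finset.univ.filter fun p : Fin n × Fin n =>
        p.1 < p.2 ∧ σ⁻¹ p.2 < σ⁻¹ p.1).card) := by
  rw [Nat.le_sqrt]
  have h := Equiv.Perm.card_filter_and_not_comm σ⁻¹ fun i : Fin n => (i : ℕ) < m
  simp only [not_lt] at h
  nth_rewrite 2 [h]
  rw [← Finset.card_product]
  refine Finset.card_le_card fun p hp => ?_
  simp only [Finset.mem_product, Finset.mem_filter, Finset.mem_univ, true_and] at hp ⊢
  simp only [Fin.lt_def]
  omega
end

section
/- Let E be a real inner product space and let Q₁, Q₂, K₁, K₂ ∈ E be unit vectors. Set δ = ⟪Q₁, K₁⟫ − ⟪Q₁, K₂⟫ and assume δ ≥ 0. Let θ ∈ [0, π] be the angle between Q₁ and Q₂ (so cos θ = ⟪Q₁, Q₂⟫). If δ > 4·sin(θ/2), then ⟪Q₂, K₁⟫ − ⟪Q₂, K₂⟫ ≥ 0. -/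
open RealInnerProductSpace

/-- The chord between two unit vectors at angle `θ ∈ [0, π]` has length `2 sin (θ/2)`. -/
theorem norm_sub_eq_two_mul_sin_half {E : Type*} [NormedAddCommGroup E] [InnerProductSpace ℝ E]
    {x y : E} (hx : ‖x‖ = 1) (hy : ‖y‖ = 1) {θ : ℝ} (hθ0 : 0 ≤ θ) (hθπ : θ ≤ Real.pi)
    (hcos : Real.cos θ = ⟪x, y⟫) : ‖x - y‖ = 2 * Real.sin (θ / 2) := by
  have hsin : 0 ≤ Real.sin (θ / 2) :=
    Real.sin_nonneg_of_nonneg_of_le_pi (by linarith) (by linarith)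
  have hhalf : Real.cos θ = 1 - 2 * Real.sin (θ / 2) ^ 2 := by
    have hdouble := Real.cos_two_mul (θ / 2)
    rw [mul_div_cancel₀ θ two_ne_zero] at hdouble
    linarith [Real.sin_sq_add_cos_sq (θ / 2)]
  rw [← sq_eq_sq₀ (norm_nonneg _) (by positivity), norm_sub_sq_real, hx, hy, ← hcos, hhalf]
  ring

/-- Let `Q₁, Q₂, K₁, K₂` be unit vectors in a real inner product space, let
`δ = ⟪Q₁, K₁⟫ - ⟪Q₁, K₂⟫ ≥ 0`, and let `θ ∈ [0, π]` be the angle between `Q₁` and `Q₂`.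
If `δ > 4 sin (θ/2)` then `⟪Q₂, K₁⟫ - ⟪Q₂, K₂⟫ ≥ 0`. -/
theorem projection_gap_transfer {E : Type*} [NormedAddCommGroup E] [InnerProductSpace ℝ E]
    (Q₁ Q₂ K₁ K₂ : E) (hQ₁ : ‖Q₁‖ = 1) (hQ₂ : ‖Q₂‖ = 1) (hK₁ : ‖K₁‖ = 1) (hK₂ : ‖K₂‖ = 1)
    (δ : ℝ) (hδ : δ = ⟪Q₁, K₁⟫ - ⟪Q₁, K₂⟫) (hδ0 : 0 ≤ δ)
    (θ : ℝ) (hθ0 : 0 ≤ θ) (hθπ : θ ≤ Real.pi) (hcos : Real.cos θ = ⟪Q₁, Q₂⟫)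
    (h : δ > 4 * Real.sin (θ / 2)) :
    ⟪Q₂, K₁⟫ - ⟪Q₂, K₂⟫ ≥ 0 := by
  have hQ := norm_sub_eq_two_mul_sin_half hQ₁ hQ₂ hθ0 hθπ hcos
  have hK : ‖K₁ - K₂‖ ≤ 2 := by
    linarith [norm_sub_le K₁ K₂]
  have hCS := real_inner_le_norm (Q₁ - Q₂) (K₁ - K₂)
  have hmul := mul_le_mul_of_nonneg_left hK (norm_nonneg (Q₁ - Q₂))
  simp only [inner_sub_left, inner_sub_right] at hCS
  linarith
end

section
/- Let E be a real inner product space, let Q, Q' ∈ E be nonzero with angle θ ∈ [0, π] between them, and let k₁, k₂ ∈ E be nonzero. Define the cosine similarity cos(u, v) = ⟪u, v⟫ / (‖u‖·‖v‖). If cos(Q, k₁) − cos(Q, k₂) > 4·sin(θ/2), then cos(Q', k₁) ≥ cos(Q', k₂). -/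
open RealInnerProductSpace

/-- The cosine similarity of two vectors in a real inner product space. -/
noncomputable def cosSim {E : Type*} [NormedAddCommGroup E] [InnerProductSpace ℝ E]
    (u v : E) : ℝ :=
  ⟪u, v⟫ / (‖u‖ * ‖v‖)

theorem cosSim_eq_inner_normalized {E : Type*} [NormedAddCommGroup E] [InnerProductSpace ℝ E]
    (u v : E) : cosSim u v = ⟪‖u‖⁻¹ • u, ‖v‖⁻¹ • v⟫ := by
  rw [cosSim, real_inner_smul_left, real_inner_smul_right, div_eq_mul_inv, mul_inv]
  ring

theorem norm_normalized {E : Type*} [NormedAddCommGroup E] [InnerProductSpace ℝ E]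
    {u : E} (hu : u ≠ 0) : ‖‖u‖⁻¹ • u‖ = 1 := by
  rw [norm_smul, norm_inv, norm_norm, inv_mul_cancel₀ (norm_ne_zero_iff.mpr hu)]

/-- The chord between two unit vectors at angle `θ` has length `2 sin (θ/2)`. -/
theorem norm_normalized_sub_normalized {E : Type*} [NormedAddCommGroup E]
    [InnerProductSpace ℝ E] {u v : E} (hu : u ≠ 0) (hv : v ≠ 0) {θ : ℝ} (hθ0 : 0 ≤ θ)
    (hθπ : θ ≤ Real.pi) (hcos : Real.cos θ = cosSim u v) :
    ‖‖u‖⁻¹ • u - ‖v‖⁻¹ • v‖ = 2 * Real.sin (θ / 2) := by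
  have hsin : 0 ≤ Real.sin (θ / 2) :=
    Real.sin_nonneg_of_nonneg_of_le_pi (by linarith) (by linarith)
  rw [← sq_eq_sq₀ (norm_nonneg _) (by positivity), norm_sub_sq_real, norm_normalized hu,
    norm_normalized hv, ← cosSim_eq_inner_normalized, ← hcos, mul_pow,
    Real.sin_sq_eq_half_sub, mul_div_cancel₀ θ two_ne_zero]
  ring

/-- Cosine similarity is Lipschitz in the direction of its first argument. -/
theorem abs_cosSim_sub_cosSim_le {E : Type*} [NormedAddCommGroup E] [InnerProductSpace ℝ E]
    {u v k : E} (hu : u ≠ 0) (hv : v ≠ 0) (hk : k ≠ 0) {θ : ℝ} (hθ0 : 0 ≤ θ)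
    (hθπ : θ ≤ Real.pi) (hcos : Real.cos θ = cosSim u v) :
    |cosSim u k - cosSim v k| ≤ 2 * Real.sin (θ / 2) := by
  rw [cosSim_eq_inner_normalized u k, cosSim_eq_inner_normalized v k, ← inner_sub_left,
    ← norm_normalized_sub_normalized hu hv hθ0 hθπ hcos]
  simpa only [norm_normalized hk, mul_one] using
    abs_real_inner_le_norm (‖u‖⁻¹ • u - ‖v‖⁻¹ • v) (‖k‖⁻¹ • k)

/-- Let `Q, Q'` be nonzero vectors with angle `θ ∈ [0, π]` between them, and `k₁, k₂`
nonzero.  If `cos(Q, k₁) - cos(Q, k₂) > 4 sin (θ/2)` then `cos(Q', k₁) ≥ cos(Q', k₂)`,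
where `cos(·,·)` denotes cosine similarity. -/
theorem cosSim_gap_transfer {E : Type*} [NormedAddCommGroup E] [InnerProductSpace ℝ E]
    (Q Q' k₁ k₂ : E) (hQ : Q ≠ 0) (hQ' : Q' ≠ 0) (hk₁ : k₁ ≠ 0) (hk₂ : k₂ ≠ 0)
    (θ : ℝ) (hθ0 : 0 ≤ θ) (hθπ : θ ≤ Real.pi) (hcos : Real.cos θ = cosSim Q Q')
    (h : cosSim Q k₁ - cosSim Q k₂ > 4 * Real.sin (θ / 2)) :
    cosSim Q' k₁ ≥ cosSim Q' k₂ := by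
  have h₁ := abs_le.mp (abs_cosSim_sub_cosSim_le hQ hQ' hk₁ hθ0 hθπ hcos)
  have h₂ := abs_le.mp (abs_cosSim_sub_cosSim_le hQ hQ' hk₂ hθ0 hθπ hcos)
  linarith [h₁.2, h₂.1]
end

section
/- Let n be a natural number, σ a permutation of Fin n, and t = |{(i, j) : i < j and σ⁻¹(j) < σ⁻¹(i)}| the number of inversions of σ viewed as a rearrangement of a strictly decreasing array. Then for every K with 1 ≤ K ≤ n, the number of indices i < K with σ⁻¹(i) < K (elements common to the first K entries of the original array and the first K entries of the rearranged array) is at least K − ⌊√t⌋. -/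
/-- For a permutation `σ` of `Fin n` with `t` inversions (viewed as a rearrangement of a
strictly decreasing array) and any `1 ≤ K ≤ n`, the number of indices `i < K` with
`σ⁻¹ i < K` is at least `K - ⌊√t⌋`. -/
theorem topK_overlap_ge (n : ℕ) (σ : Equiv.Perm (Fin n))
    (K : ℕ) (hK1 : 1 ≤ K) (hKn : K ≤ n) :
    K - Nat.sqrt ((Finset.univ.filter fun p : Fin n × Fin n =>
        p.1 < p.2 ∧ σ⁻¹ p.2 < σ⁻¹ p.1).card) ≤
      (Finset.univ.filter fun i : Fin n =>
        (i : ℕ) < K ∧ ((σ⁻¹ i : Fin n) : ℕ) < K).card := by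
  set A := Finset.univ.filter fun i : Fin n => (i : ℕ) < K with hA
  set B := Finset.univ.filter fun i : Fin n => ((σ⁻¹ i : Fin n) : ℕ) < K with hB
  have hAcard : A.card = K := by
    rw [hA, Fin.card_filter_val_lt, min_eq_right hKn]
  have hBA : B.card = A.card :=
    Finset.card_equiv σ⁻¹ (by simp [hA, hB])
  have hinter : (Finset.univ.filter fun i : Fin n =>
      (i : ℕ) < K ∧ ((σ⁻¹ i : Fin n) : ℕ) < K) = A ∩ B := by
    ext i; simp [hA, hB]
  have hsdiff : (B \ A).card = (A \ B).card := Finset.card_sdiff_comm hBA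
  have hsub : (A \ B) ×ˢ (B \ A) ⊆ Finset.univ.filter fun p : Fin n × Fin n =>
      p.1 < p.2 ∧ σ⁻¹ p.2 < σ⁻¹ p.1 := by
    rintro ⟨i, j⟩ hij
    simp only [hA, hB, Finset.mem_product, Finset.mem_sdiff, Finset.mem_filter,
      Finset.mem_univ, true_and, not_lt, Fin.lt_def] at hij ⊢
    omega
  have hsq := Finset.card_le_card hsub
  rw [Finset.card_product, hsdiff] at hsq
  have hsqrt := Nat.le_sqrt.2 hsq
  have hsplit := Finset.card_sdiff_add_card_inter A B
  rw [hinter]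
  omega
end

section
/- Let n be a natural number, σ a permutation of Fin n, and t = |{(i, j) : i < j and σ⁻¹(j) < σ⁻¹(i)}| the number of inversions of σ viewed as a rearrangement of a strictly decreasing array. Let K be a natural number with 1 ≤ K ≤ n and p ∈ [0, 1) a real number. If t < K²·(1 − p)², then the number of indices i < K with σ⁻¹(i) < K is strictly greater than p·K; equivalently, the top-K overlap ratio |{i < K : σ⁻¹(i) < K}| / K exceeds p. -/
/-- The square of the number of indices `i < K` that a permutation `τ` sends to positions `≥ K`
is at most the number of inversions of `τ`. -/
theorem sq_card_displaced_le_card_inversions {n : ℕ} (τ : Equiv.Perm (Fin n)) (K : ℕ) :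
    (Finset.univ.filter fun i : Fin n => (i : ℕ) < K ∧ ¬ (τ i : ℕ) < K).card ^ 2 ≤
      (Finset.univ.filter fun q : Fin n × Fin n => q.1 < q.2 ∧ τ q.2 < τ q.1).card := by
  have hcard : (Finset.univ.filter fun i : Fin n => (i : ℕ) < K).card =
      (Finset.univ.filter fun i : Fin n => (τ i : ℕ) < K).card :=
    Finset.card_equiv τ.symm (by simp)
  have hcomm : (Finset.univ.filter fun i : Fin n => (i : ℕ) < K ∧ ¬ (τ i : ℕ) < K).card =
      (Finset.univ.filter fun i : Fin n => (τ i : ℕ) < K ∧ ¬ (i : ℕ) < K).card := by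
    rw [Finset.filter_and_not, Finset.filter_and_not]
    exact Finset.card_sdiff_comm hcard
  rw [sq]
  nth_rw 2 [hcomm]
  rw [← Finset.card_product]
  refine Finset.card_le_card fun q hq => ?_
  simp only [Finset.mem_product, Finset.mem_filter, Finset.mem_univ, true_and] at hq ⊢
  simp only [Fin.lt_def]
  omega

/-- If the number of inversions `t` of `σ` satisfies `t < K² (1 - p)²` with `1 ≤ K ≤ n` and
`p ∈ [0, 1)`, then the number of indices `i < K` with `σ⁻¹ i < K` exceeds `p · K`;
equivalently the top-`K` overlap ratio exceeds `p`. -/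
theorem topK_overlap_ratio_gt (n : ℕ) (σ : Equiv.Perm (Fin n))
    (K : ℕ) (hK1 : 1 ≤ K) (hKn : K ≤ n) (p : ℝ) (hp0 : 0 ≤ p) (hp1 : p < 1)
    (ht : ((Finset.univ.filter fun q : Fin n × Fin n =>
        q.1 < q.2 ∧ σ⁻¹ q.2 < σ⁻¹ q.1).card : ℝ) < (K : ℝ) ^ 2 * (1 - p) ^ 2) :
    (((Finset.univ.filter fun i : Fin n =>
        (i : ℕ) < K ∧ ((σ⁻¹ i : Fin n) : ℕ) < K).card : ℝ) > p * K) ∧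
      (((Finset.univ.filter fun i : Fin n =>
        (i : ℕ) < K ∧ ((σ⁻¹ i : Fin n) : ℕ) < K).card : ℝ) / (K : ℝ) > p) := by
  set kept := (Finset.univ.filter fun i : Fin n =>
    (i : ℕ) < K ∧ ((σ⁻¹ i : Fin n) : ℕ) < K).card with hkept
  have hinv := sq_card_displaced_le_card_inversions σ⁻¹ K
  set displaced := (Finset.univ.filter fun i : Fin n =>
    (i : ℕ) < K ∧ ¬ ((σ⁻¹ i : Fin n) : ℕ) < K).card with hdisplaced
  have hsum : kept + displaced = K := by
    rw [hkept, hdisplaced, ← Finset.filter_filter, ← Finset.filter_filter,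
      Finset.card_filter_add_card_filter_not, Fin.card_filter_val_lt, min_eq_right hKn]
  have hsumR : (kept : ℝ) + displaced = K := by exact_mod_cast hsum
  have hKpos : (0 : ℝ) < K := by exact_mod_cast hK1
  have hsq : (displaced : ℝ) ^ 2 < (K * (1 - p)) ^ 2 := by
    rw [mul_pow]
    exact lt_of_le_of_lt (by exact_mod_cast hinv) ht
  have hlt : (displaced : ℝ) < K * (1 - p) :=
    lt_of_pow_lt_pow_left₀ 2 (mul_nonneg hKpos.le (sub_nonneg.2 hp1.le)) hsq
  have hmain : p * K < kept := by linarith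
  exact ⟨hmain, (lt_div_iff₀ hKpos).2 hmain⟩
end
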